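/- arXiv:1803.06172 — 7 statements merged into one kernel-verified Lean document; each statement's English description precedes it below -/
import Mathlib

section
/- Let f_d : [0,∞) → [0,∞) be measurable with ∫_{ℝ²} f_d(‖y‖) dy = 1. Then for every r ≥ 0, ∫_0^∞ G(r ∣ s) · s ds = r²/2. -/
open MeasureTheory Real Set

/-- `G f r s = 2 ∫_0^r ∫_0^π u f(√(u² + s² − 2us cos φ)) dφ du`. -/
noncomputable def G (f : ℝ → ℝ) (r s : ℝ) : ℝ :=
  2 * ∫ u in (0:ℝ)..r, ∫ φ in (0:ℝ)..π, u * f (Real.sqrt (u^2 + s^2 - 2*u*s*Real.cos φ))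

open scoped ENNReal

theorem Complex.norm_polarCoord_symm_sub_ofReal (s φ u : ℝ) :
    ‖Complex.polarCoord.symm (s, φ) - (u : ℂ)‖
      = Real.sqrt (u^2 + s^2 - 2*u*s*Real.cos φ) := by
  rw [Complex.norm_def, Complex.polarCoord_symm_apply]
  congr 1
  simp only [Complex.normSq_apply, Complex.sub_re, Complex.sub_im, Complex.mul_re, Complex.mul_im,
    Complex.add_re, Complex.add_im, Complex.ofReal_re, Complex.ofReal_im, Complex.I_re,
    Complex.I_im]
  linear_combination s ^ 2 * Real.sin_sq_add_cos_sq φ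

theorem lintegral_complex_norm_eq_lintegral_euclideanSpace (g : ℝ → ℝ≥0∞) :
    ∫⁻ z : ℂ, g ‖z‖ = ∫⁻ y : EuclideanSpace ℝ (Fin 2), g ‖y‖ := by
  have h := Complex.orthonormalBasisOneI.repr.measurePreserving
  have he : MeasurableEmbedding Complex.orthonormalBasisOneI.repr :=
    Complex.orthonormalBasisOneI.repr.toHomeomorph.measurableEmbedding
  rw [← h.lintegral_comp_emb he]
  simp only [LinearIsometryEquiv.norm_map]

theorem lintegral_Ioo_neg_eq_two_mul (a : ℝ) (h : ℝ → ℝ≥0∞) (heven : ∀ x, h (-x) = h x) :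
    ∫⁻ x in Ioo (-a) a, h x = 2 * ∫⁻ x in Ioc 0 a, h x := by
  rcases le_or_gt a 0 with ha | ha
  · rw [Ioo_eq_empty (by linarith), Ioc_eq_empty (by linarith)]
    simp
  have hneg : ∫⁻ x in Ioo (-a) 0, h x = ∫⁻ x in Ioo 0 a, h x := by
    have hm := (Measure.measurePreserving_neg (volume : Measure ℝ)).setLIntegral_comp_preimage_emb
      (MeasurableEquiv.neg ℝ).measurableEmbedding h (Ioo 0 a)
    simpa [heven] using hm
  rw [← Ioo_union_Ico_eq_Ioo (b := 0) (by linarith) ha.le,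
    lintegral_union measurableSet_Ico (by
      rw [Set.disjoint_left]; intro x hx hx'; exact absurd hx.2 (not_lt.2 hx'.1)), hneg,
    two_mul, setLIntegral_congr (Ioo_ae_eq_Ioc (a := (0:ℝ)) (b := a)),
    setLIntegral_congr (Ico_ae_eq_Ioc (a := (0:ℝ)) (b := a))]

theorem two_mul_lintegral_polar_shift (g : ℝ → ℝ≥0∞) (hg : Measurable g) (u : ℝ) :
    2 * ∫⁻ s in Ioi (0:ℝ), ∫⁻ φ in Ioc 0 π,
        ENNReal.ofReal s * g (Real.sqrt (u^2 + s^2 - 2*u*s*Real.cos φ))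
      = ∫⁻ z : ℂ, g ‖z‖ := by
  have hmeas : Measurable fun p : ℝ × ℝ =>
      ENNReal.ofReal p.1 * g (Real.sqrt (u^2 + p.1^2 - 2*u*p.1*Real.cos p.2)) := by
    fun_prop
  rw [← lintegral_sub_right_eq_self (fun z : ℂ => g ‖z‖) (u : ℂ),
    ← Complex.lintegral_comp_polarCoord_symm, polarCoord_target]
  have hpt : ∀ p : ℝ × ℝ, ENNReal.ofReal p.1 • g ‖Complex.polarCoord.symm p - (u : ℂ)‖
      = ENNReal.ofReal p.1 * g (Real.sqrt (u^2 + p.1^2 - 2*u*p.1*Real.cos p.2)) := fun p => by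
    rw [← Complex.norm_polarCoord_symm_sub_ofReal, smul_eq_mul]
  simp_rw [hpt]
  rw [Measure.volume_eq_prod, ← Measure.prod_restrict, lintegral_prod _ hmeas.aemeasurable,
    ← lintegral_const_mul' _ _ (by simp)]
  refine lintegral_congr fun s => ?_
  rw [lintegral_Ioo_neg_eq_two_mul]
  simp

theorem integral_G_mul_s
    (f : ℝ → ℝ) (hf : Measurable f) (hf0 : ∀ t, 0 ≤ f t)
    (hf1 : (∫ y : EuclideanSpace ℝ (Fin 2), f ‖y‖) = 1)
    (r : ℝ) (hr : 0 ≤ r) :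
    (∫ s in Set.Ioi (0:ℝ), G f r s * s) = r^2 / 2 := by
  have hg : ∫⁻ z : ℂ, ENNReal.ofReal (f ‖z‖) = 1 := by
    rw [lintegral_complex_norm_eq_lintegral_euclideanSpace fun t => ENNReal.ofReal (f t),
      ← ofReal_integral_eq_lintegral_ofReal _ (ae_of_all _ fun _ => hf0 _), hf1,
      ENNReal.ofReal_one]
    exact Integrable.of_integral_ne_zero (by rw [hf1]; exact one_ne_zero)
  set μs : Measure ℝ := volume.restrict (Ioi 0) with hμs
  set μu : Measure ℝ := volume.restrict (Ioc 0 r) with hμu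
  set μφ : Measure ℝ := volume.restrict (Ioc 0 π) with hμφ
  let D : ℝ × ℝ × ℝ → ℝ := fun p =>
    Real.sqrt (p.2.1^2 + p.1^2 - 2*p.2.1*p.1*Real.cos p.2.2)
  let K : ℝ × ℝ × ℝ → ℝ := fun p => p.2.1 * f (D p) * p.1
  have hK : Measurable K := by fun_prop
  have hpos : ∀ᵐ p ∂(μs.prod (μu.prod μφ)), 0 ≤ K p := by
    rw [hμs, hμu, hμφ, Measure.prod_restrict, Measure.prod_restrict]
    refine (ae_restrict_iff' (by measurability)).2 (ae_of_all _ ?_)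
    rintro ⟨s, u, φ⟩ ⟨hs, hu, -⟩
    exact mul_nonneg (mul_nonneg hu.1.le (hf0 _)) (le_of_lt hs)
  have hlin : ∫⁻ p, ENNReal.ofReal (K p) ∂(μs.prod (μu.prod μφ)) = ENNReal.ofReal (r^2 / 4) := by
    have hK' : Measurable fun p => ENNReal.ofReal (K p) := hK.ennreal_ofReal
    rw [lintegral_prod _ hK'.aemeasurable]
    have h1 : ∀ s, ∫⁻ q, ENNReal.ofReal (K (s, q)) ∂(μu.prod μφ)
        = ∫⁻ u, ∫⁻ φ, ENNReal.ofReal (K (s, u, φ)) ∂μφ ∂μu := fun s =>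
      lintegral_prod _ (hK'.comp measurable_prodMk_left).aemeasurable
    simp_rw [h1]
    rw [lintegral_lintegral_swap]
    swap
    · refine Measurable.aemeasurable ?_
      exact Measurable.lintegral_prod_right'
        (f := fun q : (ℝ × ℝ) × ℝ => ENNReal.ofReal (K (q.1.1, q.1.2, q.2)))
        (hK'.comp (by fun_prop))
    have h2 : ∀ u ∈ Ioc 0 r, ∫⁻ s, ∫⁻ φ, ENNReal.ofReal (K (s, u, φ)) ∂μφ ∂μs
        = ENNReal.ofReal (u / 2) := by
      intro u hu
      have h3 := two_mul_lintegral_polar_shift (fun t => ENNReal.ofReal (f t)) hf.ennreal_ofReal u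
      rw [hg] at h3
      have h4 : ∀ s φ, ENNReal.ofReal (K (s, u, φ)) = ENNReal.ofReal u * (ENNReal.ofReal s *
          ENNReal.ofReal (f (Real.sqrt (u^2 + s^2 - 2*u*s*Real.cos φ)))) := fun s φ => by
        simp only [K, D]
        rw [ENNReal.ofReal_mul (mul_nonneg hu.1.le (hf0 _)), ENNReal.ofReal_mul hu.1.le]
        ring
      simp_rw [h4, lintegral_const_mul' _ _ (ENNReal.ofReal_ne_top (r := u))]
      rw [show u / 2 = u * 2⁻¹ from rfl, ENNReal.ofReal_mul hu.1.le,
        ENNReal.ofReal_inv_of_pos two_pos, ENNReal.ofReal_ofNat]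
      congr 1
      rw [mul_comm] at h3
      exact ENNReal.eq_inv_of_mul_eq_one_left h3
    rw [setLIntegral_congr_fun measurableSet_Ioc h2, ← ofReal_integral_eq_lintegral_ofReal]
    · rw [← intervalIntegral.integral_of_le hr]
      congr 1
      rw [intervalIntegral.integral_div, integral_id]
      ring
    · exact Continuous.integrableOn_Ioc (by fun_prop)
    · refine (ae_restrict_iff' measurableSet_Ioc).2 (ae_of_all _ fun u hu => ?_)
      exact div_nonneg hu.1.le zero_le_two
  have hint : Integrable K (μs.prod (μu.prod μφ)) :=
    (lintegral_ofReal_ne_top_iff_integrable hK.aestronglyMeasurable hpos).1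
      (by rw [hlin]; exact ENNReal.ofReal_ne_top)
  have htot : ∫ p, K p ∂(μs.prod (μu.prod μφ)) = r^2 / 4 := by
    rw [integral_eq_lintegral_of_nonneg_ae hpos hK.aestronglyMeasurable, hlin,
      ENNReal.toReal_ofReal (by positivity)]
  have hG : ∀ᵐ s ∂μs, G f r s * s = 2 * ∫ q, K (s, q) ∂(μu.prod μφ) := by
    filter_upwards [hint.prod_right_ae] with s hs
    rw [integral_prod _ hs, G, intervalIntegral.integral_of_le hr, mul_assoc, ← integral_mul_const]
    simp_rw [intervalIntegral.integral_of_le pi_pos.le, ← integral_mul_const]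
    rfl
  rw [integral_congr_ae hG, integral_const_mul, ← integral_prod _ hint, htot]
  ring
end

section
/- Let σ > 0 and f_d^{TPP}(t) = exp(−t²/(2σ²))/(2πσ²). Then for all r, s ≥ 0, G(r ∣ s) = 1 − Q_1(s/σ, r/σ), where Q_1 is the first-order Marcum Q-function Q_1(a,b) = ∫_b^∞ x exp(−(x² + a²)/2) I_0(ax) dx with I_0(z) = (1/π) ∫_0^π e^{z cos φ} dφ. -/
open MeasureTheory Real Set

/-- Modified Bessel function of the first kind of order zero. -/
noncomputable def I0 (z : ℝ) : ℝ := (1/π) * ∫ φ in (0:ℝ)..π, Real.exp (z * Real.cos φ)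

/-- First-order Marcum Q-function. -/
noncomputable def Q1 (a b : ℝ) : ℝ :=
  ∫ x in Set.Ioi b, x * Real.exp (-(x^2 + a^2) / 2) * I0 (a*x)

/-- Thomas point process daughter density with parameter `σ`. -/
noncomputable def fTPP (σ t : ℝ) : ℝ := Real.exp (-t^2 / (2*σ^2)) / (2*π*σ^2)

/-- The radial density whose tail integral is `Q1 a`. -/
noncomputable def riceDensity (a x : ℝ) : ℝ := x * Real.exp (-(x^2 + a^2) / 2) * I0 (a*x)

lemma integral_comp_cos_symmetric (g : ℝ → ℝ) (hg : Continuous g) :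
    ∫ φ in (-π)..π, g (Real.cos φ) = 2 * ∫ φ in (0:ℝ)..π, g (Real.cos φ) := by
  have hc : Continuous fun φ => g (Real.cos φ) := hg.comp Real.continuous_cos
  rw [← intervalIntegral.integral_add_adjacent_intervals (b := 0)
    (hc.intervalIntegrable _ _) (hc.intervalIntegrable _ _)]
  have h := intervalIntegral.integral_comp_neg (a := 0) (b := π) (fun φ => g (Real.cos φ))
  simp only [Real.cos_neg, neg_zero] at h
  rw [← h]; ring

lemma integral_shifted_gaussian_plane (a : ℝ) :
    ∫ p : ℝ × ℝ, Real.exp (-((p.1 - a)^2 + p.2^2) / 2) = 2 * π := by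
  have h1 : ∀ p : ℝ × ℝ, Real.exp (-((p.1 - a)^2 + p.2^2) / 2)
      = Real.exp (-(1/2) * (p.1 - a)^2) * Real.exp (-(1/2) * p.2^2) := by
    intro p; rw [← Real.exp_add]; congr 1; ring
  simp_rw [h1]
  rw [Measure.volume_eq_prod, integral_prod_mul (fun x : ℝ => Real.exp (-(1/2) * (x - a)^2))
    (fun y : ℝ => Real.exp (-(1/2) * y^2)),
    integral_sub_right_eq_self (fun x : ℝ => Real.exp (-(1/2) * x^2)) a, integral_gaussian,
    Real.mul_self_sqrt (by positivity)]
  ring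

lemma integral_angular (a x : ℝ) :
    ∫ φ in Ioo (-π) π, x * Real.exp (-((x * Real.cos φ - a)^2 + (x * Real.sin φ)^2) / 2)
      = 2 * π * riceDensity a x := by
  rw [← integral_Ioc_eq_integral_Ioo, ← intervalIntegral.integral_of_le (by linarith [pi_pos])]
  have h : ∀ φ, x * Real.exp (-((x * Real.cos φ - a)^2 + (x * Real.sin φ)^2) / 2)
      = (x * Real.exp (-(x^2 + a^2) / 2)) * Real.exp (a * x * Real.cos φ) := by
    intro φ
    rw [mul_assoc, ← Real.exp_add]; congr 2
    linear_combination (-x^2/2) * Real.sin_sq_add_cos_sq φ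
  simp_rw [h]
  rw [intervalIntegral.integral_const_mul,
    integral_comp_cos_symmetric (fun c => Real.exp (a * x * c)) (by fun_prop), riceDensity, I0]
  field_simp

lemma integrableOn_and_integral_riceDensity (a : ℝ) :
    IntegrableOn (riceDensity a) (Ioi 0) ∧ ∫ x in Ioi (0:ℝ), riceDensity a x = 1 := by
  have hpolar := integral_comp_polarCoord_symm
    (fun p : ℝ × ℝ => Real.exp (-((p.1 - a)^2 + p.2^2) / 2))
  rw [integral_shifted_gaussian_plane] at hpolar
  simp only [polarCoord_target, polarCoord_symm_apply, smul_eq_mul] at hpolar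
  have hint : IntegrableOn (fun p : ℝ × ℝ => p.1 *
      Real.exp (-((p.1 * Real.cos p.2 - a)^2 + (p.1 * Real.sin p.2)^2) / 2))
      (Ioi 0 ×ˢ Ioo (-π) π) := by
    by_contra hn
    rw [integral_undef hn] at hpolar
    linarith [pi_pos]
  rw [Measure.volume_eq_prod] at hpolar hint
  rw [setIntegral_prod _ hint] at hpolar
  rw [IntegrableOn, ← Measure.prod_restrict] at hint
  have hi := hint.integral_prod_left
  simp only [integral_angular] at hpolar hi
  have hpi : (2 * π) ≠ 0 := by positivity
  refine ⟨(integrable_const_mul_iff (IsUnit.mk0 _ hpi) _).1 hi, ?_⟩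
  rw [integral_const_mul] at hpolar
  exact mul_left_cancel₀ hpi (hpolar.trans (mul_one _).symm)

lemma integral_fTPP_angular (σ : ℝ) (hσ : 0 < σ) (s u : ℝ) :
    ∫ φ in (0:ℝ)..π, u * fTPP σ (Real.sqrt (u^2 + s^2 - 2*u*s*Real.cos φ))
      = (1 / (2 * σ)) * riceDensity (s/σ) (u/σ) := by
  have h : ∀ φ, u * fTPP σ (Real.sqrt (u^2 + s^2 - 2*u*s*Real.cos φ))
      = (u * Real.exp (-((u/σ)^2 + (s/σ)^2) / 2) / (2*π*σ^2))
        * Real.exp (s/σ * (u/σ) * Real.cos φ) := by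
    intro φ
    have hnn : 0 ≤ u^2 + s^2 - 2*u*s*Real.cos φ := by
      nlinarith [sq_nonneg (u - s * Real.cos φ), sq_nonneg (s * Real.sin φ),
        Real.sin_sq_add_cos_sq φ]
    have he : -(u^2 + s^2 - 2*u*s*Real.cos φ) / (2*σ^2)
        = -((u/σ)^2 + (s/σ)^2) / 2 + s/σ * (u/σ) * Real.cos φ := by
      field_simp; ring
    rw [fTPP, Real.sq_sqrt hnn, he, Real.exp_add]
    ring
  simp_rw [h]
  rw [intervalIntegral.integral_const_mul, riceDensity, I0]
  field_simp

theorem G_TPP_eq_one_sub_marcumQ (σ : ℝ) (hσ : 0 < σ) (r s : ℝ) (hr : 0 ≤ r) (hs : 0 ≤ s) :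
    G (fTPP σ) r s = 1 - Q1 (s/σ) (r/σ) := by
  obtain ⟨hint, hone⟩ := integrableOn_and_integral_riceDensity (s/σ)
  have hb : 0 ≤ r/σ := by positivity
  have hsplit : (∫ x in (0:ℝ)..(r/σ), riceDensity (s/σ) x) + Q1 (s/σ) (r/σ) = 1 := by
    rw [← hone, intervalIntegral.integral_of_le hb, ← Ioc_union_Ioi_eq_Ioi hb,
      setIntegral_union (Ioc_disjoint_Ioi le_rfl) measurableSet_Ioi
        (hint.mono_set Ioc_subset_Ioi_self) (hint.mono_set (Ioi_subset_Ioi hb))]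
    rfl
  rw [G]
  simp_rw [integral_fTPP_angular σ hσ s]
  rw [intervalIntegral.integral_const_mul,
    intervalIntegral.integral_comp_div (riceDensity (s/σ)) hσ.ne', zero_div, smul_eq_mul,
    ← eq_sub_of_add_eq hsplit]
  field_simp
end

section
/- For every a ≥ 0, ∫_0^∞ x exp(−(x² + a²)/2) I_0(ax) dx = 1, where I_0(z) = (1/π) ∫_0^π e^{z cos φ} dφ; equivalently, the first-order Marcum Q-function satisfies Q_1(a, 0) = 1. -/
open MeasureTheory Real Set

theorem integrable_polar_of_integrable {E : Type*} [NormedAddCommGroup E] [NormedSpace ℝ E]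
    {f : ℝ × ℝ → E} (hf : Integrable f) :
    IntegrableOn (fun p : ℝ × ℝ => p.1 • f (polarCoord.symm p)) polarCoord.target := by
  have h := (integrableOn_image_iff_integrableOn_abs_det_fderiv_smul volume
    polarCoord.open_target.measurableSet
    (fun p _ => (hasFDerivAt_polarCoord_symm p).hasFDerivWithinAt)
    polarCoord.symm.injOn f).1 hf.integrableOn
  refine h.congr_fun (fun p hp => ?_) polarCoord.open_target.measurableSet
  simp only [det_fderivPolarCoordSymm]
  rw [abs_of_pos hp.1]

theorem integral_Ioo_neg_pi_pi_exp_mul_cos (z : ℝ) :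
    ∫ φ in Ioo (-π) π, Real.exp (z * Real.cos φ) = 2 * π * I0 z := by
  have hc : Continuous fun φ : ℝ => Real.exp (z * Real.cos φ) := by fun_prop
  have hneg : ∫ φ in (-π)..0, Real.exp (z * Real.cos φ)
      = ∫ φ in (0:ℝ)..π, Real.exp (z * Real.cos φ) := by
    simpa using (intervalIntegral.integral_comp_neg (a := 0) (b := π)
      (fun φ => Real.exp (z * Real.cos φ))).symm
  rw [← integral_Ioc_eq_integral_Ioo,
    ← intervalIntegral.integral_of_le (by linarith [pi_pos]),
    ← intervalIntegral.integral_add_adjacent_intervals (b := 0)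
      (hc.intervalIntegrable _ _) (hc.intervalIntegrable _ _), hneg, I0]
  field_simp [pi_ne_zero]
  ring

/-- The unnormalized standard Gaussian weight on the plane, centred at `(a, 0)`. -/
noncomputable def shiftedGaussian (a : ℝ) (p : ℝ × ℝ) : ℝ :=
  Real.exp (-(1 / 2) * (p.1 - a) ^ 2) * Real.exp (-(1 / 2) * p.2 ^ 2)

theorem integrable_shiftedGaussian (a : ℝ) : Integrable (shiftedGaussian a) := by
  have h := integrable_exp_neg_mul_sq (b := 1 / 2) (by norm_num)
  exact (h.comp_sub_right a).mul_prod h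

theorem integral_shiftedGaussian (a : ℝ) : ∫ p, shiftedGaussian a p = 2 * π := by
  unfold shiftedGaussian
  rw [Measure.volume_eq_prod, integral_prod_mul (fun x : ℝ => Real.exp (-(1 / 2) * (x - a) ^ 2))
      (fun y : ℝ => Real.exp (-(1 / 2) * y ^ 2)),
    integral_sub_right_eq_self (fun x : ℝ => Real.exp (-(1 / 2) * x ^ 2)) a,
    integral_gaussian, Real.mul_self_sqrt (by positivity)]
  ring

theorem shiftedGaussian_polarCoord_symm (a r φ : ℝ) :
    shiftedGaussian a (polarCoord.symm (r, φ))
      = Real.exp (-(r ^ 2 + a ^ 2) / 2) * Real.exp (a * r * Real.cos φ) := by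
  simp only [shiftedGaussian, polarCoord_symm_apply, ← Real.exp_add]
  congr 1
  linear_combination (-(r ^ 2) / 2) * Real.sin_sq_add_cos_sq φ

theorem integral_Ioi_zero_mul_exp_mul_I0 (a : ℝ) :
    ∫ x in Ioi (0:ℝ), x * Real.exp (-(x ^ 2 + a ^ 2) / 2) * I0 (a * x) = 1 := by
  have h := integral_comp_polarCoord_symm (shiftedGaussian a)
  have hi := integrable_polar_of_integrable (integrable_shiftedGaussian a)
  rw [integral_shiftedGaussian, polarCoord_target, Measure.volume_eq_prod,
    setIntegral_prod _ hi] at h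
  simp only [shiftedGaussian_polarCoord_symm, smul_eq_mul, integral_const_mul,
    integral_Ioo_neg_pi_pi_exp_mul_cos] at h
  refine mul_left_cancel₀ Real.two_pi_pos.ne' ?_
  rw [mul_one, ← integral_const_mul]
  refine Eq.trans (integral_congr_ae (Filter.Eventually.of_forall fun x => ?_)) h
  ring

theorem marcumQ_at_zero (a : ℝ) (ha : 0 ≤ a) :
    (∫ x in Set.Ioi (0:ℝ), x * Real.exp (-(x^2 + a^2) / 2) * I0 (a*x)) = 1 ∧ Q1 a 0 = 1 := by
  exact ⟨integral_Ioi_zero_mul_exp_mul_I0 a, integral_Ioi_zero_mul_exp_mul_I0 a⟩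
end

section
/- Let r_d > 0 and f_d^{MCP}(t) = 𝟙_{[0, r_d]}(t)/(π r_d²). Then for all s > 0 and r ≥ 0, G(r ∣ s) = (1/r_d²) · { [min(r, (r_d − s)^+)]² + (2/π) ∫_{min(r, |r_d − s|)}^{min(r, r_d + s)} u · arccos((u² + s² − r_d²)/(2us)) du }, where x^+ = max(x, 0). -/
open MeasureTheory Real Set

/-- Matérn cluster process daughter density with parameter `rd`. -/
noncomputable def fMCP (rd t : ℝ) : ℝ :=
  Set.indicator (Set.Icc 0 rd) (fun _ => 1 / (π * rd^2)) t

lemma le_arccos_iff_of_pos {c φ : ℝ} (hφ : 0 < φ) (hφπ : φ ≤ π) :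
    φ ≤ Real.arccos c ↔ c ≤ Real.cos φ := by
  constructor
  · intro h
    have hc1 : c ≤ 1 := by
      by_contra! hc
      rw [Real.arccos_of_one_le hc.le] at h
      linarith
    rcases le_total c (-1) with hc | hc
    · exact hc.trans (Real.neg_one_le_cos φ)
    · calc c = Real.cos (Real.arccos c) := (Real.cos_arccos hc hc1).symm
        _ ≤ Real.cos φ := Real.cos_le_cos_of_nonneg_of_le_pi hφ.le (Real.arccos_le_pi c) h
  · intro h
    simpa [Real.arccos_cos hφ.le hφπ] using Real.antitone_arccos h

/-- The angular integral: the circle of radius `u` meets the disc of radius `rd` whose centre is at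
distance `s` where the polar angle is at most the arccosine. -/
lemma integral_mul_fMCP {rd s u : ℝ} (hrd : 0 < rd) (hs : 0 < s) (hu : 0 ≤ u) :
    ∫ φ in (0:ℝ)..π, u * fMCP rd (Real.sqrt (u^2 + s^2 - 2*u*s*Real.cos φ)) =
      1 / (π * rd^2) * (u * Real.arccos ((u^2 + s^2 - rd^2) / (2*u*s))) := by
  rcases hu.eq_or_lt with rfl | hu
  · simp
  set c := (u^2 + s^2 - rd^2) / (2*u*s) with hc
  have hcongr : ∫ φ in (0:ℝ)..π, u * fMCP rd (Real.sqrt (u^2 + s^2 - 2*u*s*Real.cos φ)) =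
      ∫ φ in (0:ℝ)..π,
        Set.indicator {φ | φ ≤ Real.arccos c} (fun _ => u * (1 / (π * rd^2))) φ := by
    refine intervalIntegral.integral_congr_ae (Filter.Eventually.of_forall fun φ hφ => ?_)
    rw [Set.uIoc_of_le Real.pi_pos.le] at hφ
    have hiff : Real.sqrt (u^2 + s^2 - 2*u*s*Real.cos φ) ≤ rd ↔ φ ≤ Real.arccos c := by
      rw [Real.sqrt_le_left hrd.le, le_arccos_iff_of_pos hφ.1 hφ.2, hc,
        div_le_iff₀ (by positivity)]
      constructor <;> intro h <;> linarith
    simp only [fMCP, Set.indicator_apply, Set.mem_Icc, Set.mem_ofPred_eq, Real.sqrt_nonneg,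
      true_and, hiff, mul_ite, mul_zero]
  rw [hcongr, intervalIntegral.integral_indicator ⟨Real.arccos_nonneg c, Real.arccos_le_pi c⟩,
    intervalIntegral.integral_const, smul_eq_mul]
  ring

lemma intervalIntegrable_mul_arccos {g : ℝ → ℝ} (hg : Measurable g) (a b : ℝ) :
    IntervalIntegrable (fun u => u * Real.arccos (g u)) volume a b := by
  have hid : IntervalIntegrable (fun u : ℝ => π * u) volume a b :=
    (continuous_const.mul continuous_id).intervalIntegrable a b
  refine hid.mono_fun
    (measurable_id.mul (Real.continuous_arccos.measurable.comp hg)).aestronglyMeasurable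
    (Filter.Eventually.of_forall fun u => ?_)
  simp only [norm_mul, Real.norm_eq_abs, abs_of_pos Real.pi_pos,
    abs_of_nonneg (Real.arccos_nonneg (g u))]
  rw [mul_comm]
  exact mul_le_mul_of_nonneg_right (Real.arccos_le_pi _) (abs_nonneg u)

theorem G_MCP (rd : ℝ) (hrd : 0 < rd) (s : ℝ) (hs : 0 < s) (r : ℝ) (hr : 0 ≤ r) :
    G (fMCP rd) r s =
      (1 / rd^2) *
        ((min r (max (rd - s) 0))^2 +
          (2/π) * ∫ u in (min r |rd - s|)..(min r (rd + s)),
            u * Real.arccos ((u^2 + s^2 - rd^2) / (2*u*s))) := by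
  have hmeas : Measurable fun u : ℝ => (u^2 + s^2 - rd^2) / (2*u*s) := by fun_prop
  have hint := intervalIntegrable_mul_arccos hmeas
  set h : ℝ → ℝ := fun u => u * Real.arccos ((u^2 + s^2 - rd^2) / (2*u*s)) with hh
  set a := min r |rd - s| with ha
  set b := min r (rd + s) with hb
  have ha0 : 0 ≤ a := le_min hr (abs_nonneg _)
  have hb0 : 0 ≤ b := le_min hr (by positivity)
  have hbr : b ≤ r := min_le_left _ _
  have hG : G (fMCP rd) r s = 2 * (1 / (π * rd^2) * ∫ u in (0:ℝ)..r, h u) := by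
    rw [G, ← intervalIntegral.integral_const_mul (1 / (π * rd^2))]
    refine congrArg (2 * ·) ?_
    apply intervalIntegral.integral_congr
    intro u hu
    rw [Set.uIcc_of_le hr] at hu
    exact integral_mul_fMCP hrd hs hu.1
  have hfar : ∫ u in b..r, h u = 0 := by
    refine intervalIntegral.integral_zero_ae (Filter.Eventually.of_forall fun u hu => ?_)
    rw [Set.uIoc_of_le hbr] at hu
    have hu0 : 0 < u := hb0.trans_lt hu.1
    have hsu : rd + s ≤ u := by
      rcases min_lt_iff.mp hu.1 with h1 | h1
      · exact absurd hu.2 h1.not_ge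
      · exact h1.le
    have hc : 1 ≤ (u^2 + s^2 - rd^2) / (2*u*s) := by
      rw [le_div_iff₀ (by positivity)]
      nlinarith
    simp only [hh, Real.arccos_of_one_le hc, mul_zero]
  have hnear : ∫ u in (0:ℝ)..a, h u = π / 2 * (min r (max (rd - s) 0))^2 := by
    rcases le_total s rd with hsr | hsr
    · have haeq : min r (max (rd - s) 0) = a := by
        rw [ha, abs_of_nonneg (sub_nonneg.2 hsr), max_eq_left (sub_nonneg.2 hsr)]
      have hcongr : ∫ u in (0:ℝ)..a, h u = ∫ u in (0:ℝ)..a, u * π := by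
        refine intervalIntegral.integral_congr_ae (Filter.Eventually.of_forall fun u hu => ?_)
        rw [Set.uIoc_of_le ha0] at hu
        have hus : u ≤ rd - s :=
          hu.2.trans ((min_le_right _ _).trans (abs_of_nonneg (sub_nonneg.2 hsr)).le)
        have hu0 : 0 < u := hu.1
        have hc : (u^2 + s^2 - rd^2) / (2*u*s) ≤ -1 := by
          rw [div_le_iff₀ (by positivity)]
          nlinarith
        simp only [hh, Real.arccos_of_le_neg_one hc]
      rw [hcongr, haeq, intervalIntegral.integral_mul_const, integral_id]
      ring
    · have hzero : min r (max (rd - s) 0) = 0 := by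
        rw [max_eq_right (sub_nonpos.2 hsr), min_eq_right hr]
      rw [hzero]
      simp only [ne_eq, OfNat.ofNat_ne_zero, not_false_eq_true, zero_pow, mul_zero]
      refine intervalIntegral.integral_zero_ae (Filter.Eventually.of_forall fun u hu => ?_)
      rw [Set.uIoc_of_le ha0] at hu
      have hus : u ≤ -(rd - s) :=
        hu.2.trans ((min_le_right _ _).trans (abs_of_nonpos (sub_nonpos.2 hsr)).le)
      have hu0 : 0 < u := hu.1
      have hc : 1 ≤ (u^2 + s^2 - rd^2) / (2*u*s) := by
        rw [le_div_iff₀ (by positivity)]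
        nlinarith
      simp only [hh, Real.arccos_of_one_le hc, mul_zero]
  rw [hG, ← intervalIntegral.integral_add_adjacent_intervals (hint 0 b) (hint b r),
    ← intervalIntegral.integral_add_adjacent_intervals (hint 0 a) (hint a b), hfar, hnear]
  field_simp
  ring
end

section
/- Let r_d > 0 and f_d^{MCP}(t) = 𝟙_{[0, r_d]}(t)/(π r_d²). Then for all s > 0 and all r > 0 with r ≠ (r_d − s)^+, g(r ∣ s) = (2r/r_d²) · { 𝟙_{[0, (r_d − s)^+]}(r) + (1/π) arccos((r² + s² − r_d²)/(2rs)) · 𝟙_{[|r_d − s|, r_d + s]}(r) }, where g(r ∣ s) = 2r ∫_0^π f_d^{MCP}(√(r² + s² − 2rs cos φ)) dφ and x^+ = max(x, 0). -/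
open MeasureTheory Real Set

/-- `g f r s = 2r ∫_0^π f(√(r² + s² − 2rs cos φ)) dφ`. -/
noncomputable def g (f : ℝ → ℝ) (r s : ℝ) : ℝ :=
  2 * r * ∫ φ in (0:ℝ)..π, f (Real.sqrt (r^2 + s^2 - 2*r*s*Real.cos φ))

theorem le_cos_iff_le_arccos {c φ : ℝ} (h0 : 0 < φ) (hπ : φ ≤ π) :
    c ≤ Real.cos φ ↔ φ ≤ Real.arccos c := by
  constructor
  · intro h
    rw [← Real.arccos_cos h0.le hπ]
    exact Real.antitone_arccos h
  · intro h
    rcases le_total c (-1) with hc | hc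
    · exact hc.trans (Real.neg_one_le_cos φ)
    rcases le_total 1 c with hc' | hc'
    · rw [Real.arccos_eq_zero.2 hc'] at h
      linarith
    · rw [← Real.cos_arccos hc hc']
      exact Real.cos_le_cos_of_nonneg_of_le_pi h0.le (Real.arccos_le_pi c) h

theorem g_fMCP_eq_arccos {rd r s : ℝ} (hrd : 0 < rd) (hs : 0 < s) (hr : 0 < r) :
    g (fMCP rd) r s =
      2 * r / rd^2 * ((1/π) * Real.arccos ((r^2 + s^2 - rd^2) / (2*r*s))) := by
  set c := (r^2 + s^2 - rd^2) / (2*r*s) with hc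
  have hrs : 0 < 2 * r * s := by positivity
  have hind : ∀ φ ∈ Set.Ioc (0:ℝ) π,
      fMCP rd (Real.sqrt (r^2 + s^2 - 2*r*s*Real.cos φ)) =
        Set.indicator (Set.Iic (Real.arccos c)) (fun _ => 1 / (π * rd^2)) φ := by
    intro φ hφ
    have hiff : Real.sqrt (r^2 + s^2 - 2*r*s*Real.cos φ) ∈ Set.Icc 0 rd ↔
        φ ∈ Set.Iic (Real.arccos c) := by
      rw [Set.mem_Iic, ← le_cos_iff_le_arccos hφ.1 hφ.2, hc, div_le_iff₀ hrs, Set.mem_Icc,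
        Real.sqrt_le_left hrd.le]
      constructor
      · rintro ⟨-, h⟩
        linarith
      · intro h
        exact ⟨Real.sqrt_nonneg _, by linarith⟩
    classical
    simp only [fMCP, Set.indicator_apply, hiff]
  have hset : Set.Ioc (0:ℝ) π ∩ Set.Iic (Real.arccos c) = Set.Ioc 0 (Real.arccos c) := by
    rw [Set.Ioc_inter_Iic, min_eq_right (Real.arccos_le_pi c)]
  rw [g, intervalIntegral.integral_of_le Real.pi_pos.le,
    setIntegral_congr_fun measurableSet_Ioc hind, setIntegral_indicator measurableSet_Iic, hset,
    ← intervalIntegral.integral_of_le (Real.arccos_nonneg c), intervalIntegral.integral_const,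
    smul_eq_mul]
  field_simp
  ring

theorem g_MCP (rd : ℝ) (hrd : 0 < rd) (s : ℝ) (hs : 0 < s) (r : ℝ) (hr : 0 < r)
    (hne : r ≠ max (rd - s) 0) :
    g (fMCP rd) r s =
      (2*r / rd^2) *
        (Set.indicator (Set.Icc 0 (max (rd - s) 0)) (fun _ => (1:ℝ)) r +
          (1/π) * Real.arccos ((r^2 + s^2 - rd^2) / (2*r*s)) *
            Set.indicator (Set.Icc |rd - s| (rd + s)) (fun _ => (1:ℝ)) r) := by
  rw [g_fMCP_eq_arccos hrd hs hr]
  congr 1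
  have hrs : 0 < 2 * r * s := by positivity
  by_cases hin : r ≤ max (rd - s) 0
  · have hlt : r < rd - s := by
      rcases lt_max_iff.1 (lt_of_le_of_ne hin hne) with h | h
      · exact h
      · linarith
    have hout : r ∉ Set.Icc |rd - s| (rd + s) := fun h =>
      absurd (h.1.trans_lt hlt) (le_abs_self _).not_gt
    rw [Set.indicator_of_mem (Set.mem_Icc.2 ⟨hr.le, hin⟩), Set.indicator_of_notMem hout,
      Real.arccos_of_le_neg_one]
    · field_simp
      ring
    · rw [div_le_iff₀ hrs]
      nlinarith
  · rw [Set.indicator_of_notMem fun h => hin h.2, zero_add]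
    by_cases hmem : r ∈ Set.Icc |rd - s| (rd + s)
    · rw [Set.indicator_of_mem hmem, mul_one]
    · rw [Set.indicator_of_notMem hmem, mul_zero, Real.arccos_eq_zero.2, mul_zero]
      rw [le_div_iff₀ hrs]
      have hgt : rd - s < r := (le_max_left _ _).trans_lt (not_le.1 hin)
      rw [Set.mem_Icc, not_and_or, not_le, not_le, lt_abs] at hmem
      rcases hmem with (h | h) | h <;> nlinarith
end

section
/- Let f_d : [0,∞) → [0,∞) be measurable with ∫_{ℝ²} f_d(‖y‖) dy = 1, let ℓ : (0,∞) → (0,∞) be measurable with ∫_ε^∞ u ℓ(u) du < ∞ for every ε > 0, and let α > 0. Define C(r, s, θ) = exp{ −α [ 1 − ∫_r^∞ (1 + θ ℓ(u)/ℓ(r))^{−1} g(u ∣ s) du ] }. Then for all r > 0 and θ > 0, ∫_{ℝ²} |log C(r, ‖x‖, θ)| dx = 2πα ∫_0^∞ [ 1 − ∫_r^∞ (1 + θ ℓ(u)/ℓ(r))^{−1} g(u ∣ s) du ] s ds, and this quantity is finite; in fact it equals 2πα ( r²/2 + θ ∫_r^∞ u ℓ(u)/(θ ℓ(u) + ℓ(r))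 du ). -/
open MeasureTheory Real Set

/-- `C(r, s, θ) = exp{−α [1 − ∫_r^∞ (1 + θ ℓ(u)/ℓ(r))⁻¹ g(u∣s) du]}`. -/
noncomputable def Cfun (f ℓ : ℝ → ℝ) (α r s θ : ℝ) : ℝ :=
  Real.exp (-α * (1 - ∫ u in Set.Ioi r, (1 + θ * ℓ u / ℓ r)⁻¹ * g f u s))

theorem setIntegral_Ioo_neg_of_even {q : ℝ → ℝ} (hq : ∀ x, q (-x) = q x) {a : ℝ} (ha : 0 ≤ a) :
    ∫ x in Ioo (-a) a, q x = 2 * ∫ x in (0 : ℝ)..a, q x := by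
  have hleft : ∫ x, (Iio a).indicator q |x| = ∫ x in Ioo (-a) a, q x := by
    rw [← integral_indicator measurableSet_Ioo]
    congr 1 with x
    have habs : q |x| = q x := by
      rcases abs_choice x with h | h <;> rw [h]
      exact hq x
    by_cases hx : |x| < a
    · rw [indicator_of_mem (by exact hx), indicator_of_mem (by exact abs_lt.mp hx), habs]
    · have hx' : x ∉ Ioo (-a) a := fun h => hx (abs_lt.mpr h)
      rw [indicator_of_notMem (by exact hx), indicator_of_notMem hx']
  rw [← hleft, integral_comp_abs, setIntegral_indicator measurableSet_Iio, Ioi_inter_Iio,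
    intervalIntegral.integral_of_le ha, integral_Ioc_eq_integral_Ioo]

theorem exists_linearIsometryEquiv_complex_apply_eq_norm (x : EuclideanSpace ℝ (Fin 2)) :
    ∃ T : EuclideanSpace ℝ (Fin 2) ≃ₗᵢ[ℝ] ℂ, T x = (‖x‖ : ℂ) := by
  let T₀ := Complex.orthonormalBasisOneI.repr.symm
  refine ⟨T₀.trans (rotation (Circle.exp (-Complex.arg (T₀ x)))), ?_⟩
  rw [LinearIsometryEquiv.trans_apply, rotation_apply, Circle.coe_exp, ← T₀.norm_map x]
  nth_rw 2 [← Complex.norm_mul_exp_arg_mul_I (T₀ x)]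
  rw [mul_left_comm, ← Complex.exp_add]
  simp

theorem Complex.norm_ofReal_sub_polarCoord_symm (s u φ : ℝ) :
    ‖(s : ℂ) - Complex.polarCoord.symm (u, φ)‖ =
      Real.sqrt (u ^ 2 + s ^ 2 - 2 * u * s * Real.cos φ) := by
  rw [Complex.norm_def, Complex.normSq_apply, Complex.polarCoord_symm_apply]
  congr 1
  simp only [Complex.sub_re, Complex.sub_im, Complex.mul_re, Complex.mul_im, Complex.add_re,
    Complex.add_im, Complex.ofReal_re, Complex.ofReal_im, Complex.I_re, Complex.I_im]
  linear_combination u ^ 2 * Real.sin_sq_add_cos_sq φ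

theorem integral_radial_mul_radial_sub
    {f : ℝ → ℝ} (hf1 : (∫ y : EuclideanSpace ℝ (Fin 2), f ‖y‖) = 1)
    {h : ℝ → ℝ} (hh : Measurable h) {c : ℝ} (hc : ∀ u, ‖h u‖ ≤ c)
    (x : EuclideanSpace ℝ (Fin 2)) :
    ∫ y : EuclideanSpace ℝ (Fin 2), h ‖y‖ * f ‖x - y‖ =
      ∫ u in Ioi (0 : ℝ), h u * g f u ‖x‖ := by
  obtain ⟨T, hT⟩ := exists_linearIsometryEquiv_complex_apply_eq_norm x
  have hpolar : ∀ k : ℝ → ℝ, ∫ y : EuclideanSpace ℝ (Fin 2), k ‖y‖ * f ‖x - y‖ =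
      ∫ p in Ioi (0 : ℝ) ×ˢ Ioo (-π) π,
        k p.1 * (p.1 * f (Real.sqrt (p.1 ^ 2 + ‖x‖ ^ 2 - 2 * p.1 * ‖x‖ * Real.cos p.2))) := by
    intro k
    have hrot : ∫ y : EuclideanSpace ℝ (Fin 2), k ‖y‖ * f ‖x - y‖ =
        ∫ z : ℂ, k ‖z‖ * f ‖(‖x‖ : ℂ) - z‖ := by
      rw [← T.measurePreserving.integral_comp T.toHomeomorph.measurableEmbedding]
      simp only [← hT, ← map_sub, LinearIsometryEquiv.norm_map]
    rw [hrot, ← Complex.integral_comp_polarCoord_symm, polarCoord_target]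
    refine setIntegral_congr_fun (measurableSet_Ioi.prod measurableSet_Ioo) ?_
    rintro ⟨u, φ⟩ ⟨hu, -⟩
    have hu : 0 < u := hu
    simp only [Complex.norm_ofReal_sub_polarCoord_symm, Complex.norm_polarCoord_symm,
      abs_of_pos hu, smul_eq_mul]
    ring
  have hint : IntegrableOn (fun p : ℝ × ℝ =>
      p.1 * f (Real.sqrt (p.1 ^ 2 + ‖x‖ ^ 2 - 2 * p.1 * ‖x‖ * Real.cos p.2)))
      (Ioi (0 : ℝ) ×ˢ Ioo (-π) π) := by
    refine not_imp_comm.mp integral_undef ?_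
    have := hpolar (fun _ => 1)
    simp only [one_mul] at this
    rw [← this, integral_sub_left_eq_self (fun y => f ‖y‖), hf1]
    exact one_ne_zero
  have hint' : IntegrableOn (fun p : ℝ × ℝ => h p.1 *
      (p.1 * f (Real.sqrt (p.1 ^ 2 + ‖x‖ ^ 2 - 2 * p.1 * ‖x‖ * Real.cos p.2))))
      (Ioi (0 : ℝ) ×ˢ Ioo (-π) π) :=
    Integrable.bdd_mul (c := c) hint (hh.comp measurable_fst).aestronglyMeasurable
      (Filter.Eventually.of_forall fun p => hc p.1)
  rw [hpolar h, Measure.volume_eq_prod, setIntegral_prod _ hint']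
  congr 1 with u
  dsimp only
  rw [integral_const_mul, integral_const_mul, setIntegral_Ioo_neg_of_even (by simp) pi_pos.le, g]
  ring

theorem EuclideanSpace.integral_fun_norm_fin_two (v : ℝ → ℝ) :
    ∫ x : EuclideanSpace ℝ (Fin 2), v ‖x‖ = 2 * π * ∫ s in Ioi (0 : ℝ), v s * s := by
  have hball : (volume : Measure (EuclideanSpace ℝ (Fin 2))).real (Metric.ball 0 1) = π := by
    simp [Measure.real, pi_pos.le]
  rw [integral_fun_norm_addHaar, hball]
  simp [mul_assoc, mul_comm (v _)]

theorem integral_abs_log_C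
    (f : ℝ → ℝ) (hf : Measurable f) (hf0 : ∀ t, 0 ≤ f t)
    (hf1 : (∫ y : EuclideanSpace ℝ (Fin 2), f ‖y‖) = 1)
    (ℓ : ℝ → ℝ) (hℓm : Measurable ℓ) (hℓpos : ∀ u, 0 < u → 0 < ℓ u)
    (hℓint : ∀ ε, 0 < ε → IntegrableOn (fun u => u * ℓ u) (Set.Ioi ε))
    (α : ℝ) (hα : 0 < α) (r θ : ℝ) (hr : 0 < r) (hθ : 0 < θ) :
    Integrable (fun x : EuclideanSpace ℝ (Fin 2) => |Real.log (Cfun f ℓ α r ‖x‖ θ)|) ∧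
      (∫ x : EuclideanSpace ℝ (Fin 2), |Real.log (Cfun f ℓ α r ‖x‖ θ)|)
        = 2 * π * α *
          ∫ s in Set.Ioi (0:ℝ),
            (1 - ∫ u in Set.Ioi r, (1 + θ * ℓ u / ℓ r)⁻¹ * g f u s) * s ∧
      (∫ x : EuclideanSpace ℝ (Fin 2), |Real.log (Cfun f ℓ α r ‖x‖ θ)|)
        = 2 * π * α *
          (r^2 / 2 + θ * ∫ u in Set.Ioi r, u * ℓ u / (θ * ℓ u + ℓ r)) := by
  have hℓr : 0 < ℓ r := hℓpos r hr
  have hF : Integrable (fun y : EuclideanSpace ℝ (Fin 2) => f ‖y‖) :=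
    not_imp_comm.mp integral_undef (by rw [hf1]; exact one_ne_zero)
  set k : ℝ → ℝ := fun u => (1 + θ * ℓ u / ℓ r)⁻¹ with hk
  set h : ℝ → ℝ := (Ioi r).indicator k with hh
  have hkm : Measurable k := (((hℓm.const_mul θ).div_const _).const_add 1).inv
  have hhm : Measurable h := hkm.indicator measurableSet_Ioi
  have hh01 : ∀ u, 0 ≤ h u ∧ h u ≤ 1 := by
    intro u
    by_cases hu : u ∈ Ioi r
    · have hpos : 0 < θ * ℓ u / ℓ r :=
        div_pos (mul_pos hθ (hℓpos u (hr.trans hu))) hℓr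
      rw [hh, indicator_of_mem hu]
      exact ⟨by positivity, inv_le_one_of_one_le₀ (by linarith)⟩
    · rw [hh, indicator_of_notMem hu]
      exact ⟨le_rfl, zero_le_one⟩
  have hhc : ∀ u, ‖h u‖ ≤ 1 := fun u => by
    rw [Real.norm_of_nonneg (hh01 u).1]
    exact (hh01 u).2
  set v : ℝ → ℝ := fun s => 1 - ∫ u in Ioi r, k u * g f u s with hv
  have hvconv : ∀ x : EuclideanSpace ℝ (Fin 2),
      v ‖x‖ = ∫ y : EuclideanSpace ℝ (Fin 2), (1 - h ‖y‖) * f ‖x - y‖ := by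
    intro x
    have hFx : Integrable (fun y : EuclideanSpace ℝ (Fin 2) => f ‖x - y‖) := hF.comp_sub_left x
    have hFx1 : ∫ y : EuclideanSpace ℝ (Fin 2), f ‖x - y‖ = 1 := by
      rw [integral_sub_left_eq_self (fun y => f ‖y‖), hf1]
    have hhFx : Integrable (fun y : EuclideanSpace ℝ (Fin 2) => h ‖y‖ * f ‖x - y‖) :=
      hFx.bdd_mul (hhm.comp measurable_norm).aestronglyMeasurable
        (Filter.Eventually.of_forall fun y => hhc ‖y‖)
    simp only [sub_mul, one_mul]
    rw [integral_sub hFx hhFx, hFx1, integral_radial_mul_radial_sub hf1 hhm hhc, hv]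
    have hind : ∀ u, h u * g f u ‖x‖ = (Ioi r).indicator (fun u => k u * g f u ‖x‖) u :=
      fun u => (indicator_mul_left (Ioi r) k (fun u => g f u ‖x‖)).symm
    simp only [hind]
    rw [setIntegral_indicator measurableSet_Ioi, Ioi_inter_Ioi, max_eq_right hr.le]
  have hv0 : ∀ x : EuclideanSpace ℝ (Fin 2), 0 ≤ v ‖x‖ := fun x => by
    rw [hvconv]
    exact integral_nonneg fun y => mul_nonneg (sub_nonneg.2 (hh01 _).2) (hf0 _)
  have hlow : EqOn (fun u => (1 - h u) * u) (fun u => u) (Ioc 0 r) := fun u hu => by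
    simp [hh, indicator_of_notMem (show u ∉ Ioi r from not_lt.2 hu.2)]
  have hhigh : EqOn (fun u => (1 - h u) * u) (fun u => θ * (u * ℓ u / (θ * ℓ u + ℓ r)))
      (Ioi r) := fun u hu => by
    have hℓu := hℓpos u (hr.trans hu)
    have : 0 < θ * ℓ u + ℓ r := by positivity
    have : 0 < ℓ r + θ * ℓ u := by positivity
    simp only [hh, indicator_of_mem hu, hk]
    field_simp
    ring
  have hlow_int : IntegrableOn (fun u => (1 - h u) * u) (Ioc 0 r) :=
    (integrableOn_congr_fun hlow measurableSet_Ioc).2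
      ((continuous_id.integrableOn_Icc).mono_set Ioc_subset_Icc_self)
  have hhigh_int : IntegrableOn (fun u => (1 - h u) * u) (Ioi r) := by
    refine Integrable.mono' ((hℓint r hr).const_mul (θ / ℓ r))
      (((hhm.const_sub 1).mul measurable_id).aestronglyMeasurable) ?_
    filter_upwards [ae_restrict_mem measurableSet_Ioi] with u hu
    have hu0 : 0 < u := hr.trans hu
    have hℓu := hℓpos u hu0
    have heq := hhigh hu
    simp only at heq
    rw [heq, Real.norm_of_nonneg (by positivity), div_mul_eq_mul_div, mul_div_assoc θ]
    have hle : ℓ r ≤ θ * ℓ u + ℓ r := le_add_of_nonneg_left (by positivity)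
    gcongr
  have hWint : Integrable (fun y : EuclideanSpace ℝ (Fin 2) => 1 - h ‖y‖) := by
    rw [integrable_fun_norm_addHaar volume (f := fun u => 1 - h u)]
    have : IntegrableOn (fun u => (1 - h u) * u) (Ioi 0) := by
      rw [← Ioc_union_Ioi_eq_Ioi hr.le]
      exact hlow_int.union hhigh_int
    simpa [mul_comm] using this
  have hW : ∫ y : EuclideanSpace ℝ (Fin 2), (1 - h ‖y‖) =
      2 * π * (r ^ 2 / 2 + θ * ∫ u in Ioi r, u * ℓ u / (θ * ℓ u + ℓ r)) := by
    rw [EuclideanSpace.integral_fun_norm_fin_two (fun u => 1 - h u),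
      ← Ioc_union_Ioi_eq_Ioi hr.le,
      setIntegral_union (Ioc_disjoint_Ioi le_rfl) measurableSet_Ioi hlow_int hhigh_int,
      setIntegral_congr_fun measurableSet_Ioc hlow, setIntegral_congr_fun measurableSet_Ioi hhigh,
      integral_const_mul, ← intervalIntegral.integral_of_le hr.le, integral_id]
    ring
  have hvfun : (fun x : EuclideanSpace ℝ (Fin 2) => v ‖x‖) =
      convolution (fun y => 1 - h ‖y‖) (fun y => f ‖y‖) (ContinuousLinearMap.mul ℝ ℝ) volume :=
    funext hvconv
  have hvint : Integrable (fun x : EuclideanSpace ℝ (Fin 2) => v ‖x‖) := by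
    rw [hvfun]
    exact hWint.integrable_convolution _ hF
  have hvval : ∫ x : EuclideanSpace ℝ (Fin 2), v ‖x‖ =
      ∫ y : EuclideanSpace ℝ (Fin 2), (1 - h ‖y‖) := by
    rw [hvfun, integral_convolution _ hWint hF, hf1]
    simp
  have hlog : (fun x : EuclideanSpace ℝ (Fin 2) => |Real.log (Cfun f ℓ α r ‖x‖ θ)|) =
      fun x => α * v ‖x‖ := by
    funext x
    rw [Cfun, Real.log_exp, neg_mul, abs_neg]
    exact abs_of_nonneg (mul_nonneg hα.le (hv0 x))
  rw [hlog, integral_const_mul]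
  refine ⟨hvint.const_mul α, ?_, ?_⟩
  · rw [EuclideanSpace.integral_fun_norm_fin_two v]
    ring
  · rw [hvval, hW]
    ring
end

section
/- Let f_d : [0,∞) → [0,∞) be measurable with ∫_{ℝ²} f_d(‖y‖) dy = 1, let ℓ : (0,∞) → (0,∞) be measurable with ∫_ε^∞ u ℓ(u) du < ∞ for every ε > 0, and let α > 0. With C(r, s, θ) = exp{ −α [ 1 − ∫_r^∞ (1 + θ ℓ(u)/ℓ(r))^{−1} g(u ∣ s) du ] }, for all r > 0 and θ > 0 one has ∫_0^∞ [1 − C(r, s, θ)] s ds ≤ α ∫_0^∞ [ 1 − ∫_r^∞ (1 + θ ℓ(u)/ℓ(r))^{−1} g(u ∣ s) du ] s ds < ∞; in particular the exponent in M(r, θ) = exp{ −2πλ_p ∫_0^∞ [1 − C(r, s, θ)] s ds } is finite for every λ_p > 0. -/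
open MeasureTheory Real Set

open scoped ENNReal

/-- `[0, ∞]`-valued version of `g`. -/
noncomputable def lg (f : ℝ → ℝ) (r s : ℝ) : ℝ≥0∞ :=
  ENNReal.ofReal (2 * r) * ∫⁻ φ in Ioc 0 π,
    ENNReal.ofReal (f (√(r ^ 2 + s ^ 2 - 2 * r * s * Real.cos φ)))

lemma measurable_lg {f : ℝ → ℝ} (hf : Measurable f) :
    Measurable fun p : ℝ × ℝ => lg f p.1 p.2 := by
  unfold lg
  refine Measurable.mul (by fun_prop) ?_
  refine Measurable.lintegral_prod_right' (f := fun q : (ℝ × ℝ) × ℝ =>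
    ENNReal.ofReal (f (√(q.1.1 ^ 2 + q.1.2 ^ 2 - 2 * q.1.1 * q.1.2 * Real.cos q.2)))) ?_
  fun_prop

lemma g_eq_toReal_lg {f : ℝ → ℝ} (hf : Measurable f) (hf0 : ∀ t, 0 ≤ f t)
    {r : ℝ} (hr : 0 ≤ r) (s : ℝ) : g f r s = (lg f r s).toReal := by
  unfold g lg
  rw [intervalIntegral.integral_of_le Real.pi_pos.le,
    integral_eq_lintegral_of_nonneg_ae (.of_forall fun _ => hf0 _)
      (Measurable.aestronglyMeasurable (by fun_prop)),
    ENNReal.toReal_mul, ENNReal.toReal_ofReal (by positivity)]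

lemma ofReal_mul_lg_comm (f : ℝ → ℝ) {r s : ℝ} (hr : 0 ≤ r) (hs : 0 ≤ s) :
    ENNReal.ofReal s * lg f r s = ENNReal.ofReal r * lg f s r := by
  unfold lg
  rw [← mul_assoc, ← mul_assoc, ← ENNReal.ofReal_mul hs, ← ENNReal.ofReal_mul hr]
  congr 1
  · congr 1; ring
  · refine lintegral_congr fun φ => ?_
    rw [add_comm (r ^ 2), mul_right_comm 2 r s]

lemma norm_polarCoord_symm_sub (r s φ : ℝ) :
    ‖Complex.polarCoord.symm (r, φ) - s‖ = √(r ^ 2 + s ^ 2 - 2 * r * s * Real.cos φ) := by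
  rw [Complex.norm_def, Complex.normSq_apply]
  congr 1
  simp [Complex.polarCoord_symm_apply]
  simp [← Complex.ofReal_cos, ← Complex.ofReal_sin]
  nlinarith [Real.sin_sq_add_cos_sq φ]

lemma lintegral_Ioo_neg_pi_of_even {h : ℝ → ℝ≥0∞} (hh : ∀ φ, h (-φ) = h φ) :
    ∫⁻ φ in Ioo (-π) π, h φ = 2 * ∫⁻ φ in Ioc 0 π, h φ := by
  have hneg : ∫⁻ φ in Ioc (-π) 0, h φ = ∫⁻ φ in Ioc 0 π, h φ := by
    rw [← (Measure.measurePreserving_neg (volume : Measure ℝ)).setLIntegral_comp_preimage_emb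
      (MeasurableEquiv.neg ℝ).measurableEmbedding]
    simp only [hh]
    refine setLIntegral_congr ?_
    simpa using Ico_ae_eq_Ioc (μ := (volume : Measure ℝ)) (a := 0) (b := π)
  rw [setLIntegral_congr Ioo_ae_eq_Ioc,
    ← Ioc_union_Ioc_eq_Ioc (neg_nonpos.2 Real.pi_pos.le) Real.pi_pos.le,
    lintegral_union measurableSet_Ioc (Ioc_disjoint_Ioc_of_le le_rfl), hneg, two_mul]

lemma lintegral_lg {f : ℝ → ℝ} (hf : Measurable f) (hf0 : ∀ t, 0 ≤ f t)
    (hf1 : (∫ y : EuclideanSpace ℝ (Fin 2), f ‖y‖) = 1) (s : ℝ) :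
    ∫⁻ u in Ioi 0, lg f u s = 1 := by
  have h1 : ∫⁻ y : EuclideanSpace ℝ (Fin 2), ENNReal.ofReal (f ‖y‖) = 1 := by
    rw [← ofReal_integral_eq_lintegral_ofReal, hf1, ENNReal.ofReal_one]
    · by_contra h
      rw [integral_undef h] at hf1
      exact zero_ne_one hf1
    · exact .of_forall fun _ => hf0 _
  have h2 : ∫⁻ z : ℂ, ENNReal.ofReal (f ‖z‖) = 1 := by
    rw [← h1, ← (Complex.orthonormalBasisOneI.measurePreserving_repr).lintegral_comp
      (by fun_prop)]
    simp
  rw [← lintegral_sub_right_eq_self _ (s : ℂ), ← Complex.lintegral_comp_polarCoord_symm,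
    polarCoord_target, Measure.volume_eq_prod, setLIntegral_prod] at h2
  · rw [← h2]
    refine setLIntegral_congr_fun measurableSet_Ioi fun u hu => ?_
    simp only [norm_polarCoord_symm_sub, smul_eq_mul]
    rw [lintegral_const_mul _ (by fun_prop), lintegral_Ioo_neg_pi_of_even (by simp), lg,
      mul_comm 2 u, ENNReal.ofReal_mul (le_of_lt hu), ENNReal.ofReal_ofNat, mul_assoc]
  · simp only [smul_eq_mul]
    have : ∀ p : ℝ × ℝ, ‖Complex.polarCoord.symm p - s‖
        = √(p.1 ^ 2 + s ^ 2 - 2 * p.1 * s * Real.cos p.2) :=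
      fun p => norm_polarCoord_symm_sub p.1 s p.2
    simp only [this]
    fun_prop

lemma integrableOn_g {f : ℝ → ℝ} (hf : Measurable f) (hf0 : ∀ t, 0 ≤ f t)
    (hf1 : (∫ y : EuclideanSpace ℝ (Fin 2), f ‖y‖) = 1) (s : ℝ) :
    IntegrableOn (fun u => g f u s) (Ioi 0) := by
  refine IntegrableOn.congr_fun (f := fun u => (lg f u s).toReal) ?_
    (fun u hu => (g_eq_toReal_lg hf hf0 (le_of_lt hu) s).symm) measurableSet_Ioi
  refine integrable_toReal_of_lintegral_ne_top
    ((measurable_lg hf).comp measurable_prodMk_right).aemeasurable ?_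
  simp [lintegral_lg hf hf0 hf1]

lemma integral_g {f : ℝ → ℝ} (hf : Measurable f) (hf0 : ∀ t, 0 ≤ f t)
    (hf1 : (∫ y : EuclideanSpace ℝ (Fin 2), f ‖y‖) = 1) (s : ℝ) :
    ∫ u in Ioi 0, g f u s = 1 := by
  have hm : Measurable fun u => lg f u s := (measurable_lg hf).comp measurable_prodMk_right
  rw [setIntegral_congr_fun measurableSet_Ioi
      (fun u hu => g_eq_toReal_lg hf hf0 (le_of_lt hu) s),
    integral_toReal hm.aemeasurable (ae_lt_top hm (by simp [lintegral_lg hf hf0 hf1])),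
    lintegral_lg hf hf0 hf1, ENNReal.toReal_one]

lemma g_nonneg {f : ℝ → ℝ} (hf0 : ∀ t, 0 ≤ f t) {r : ℝ} (hr : 0 ≤ r) (s : ℝ) :
    0 ≤ g f r s :=
  mul_nonneg (by positivity)
    (intervalIntegral.integral_nonneg Real.pi_pos.le fun _ _ => hf0 _)

lemma measurable_g {f : ℝ → ℝ} (hf : Measurable f) :
    Measurable fun p : ℝ × ℝ => g f p.1 p.2 := by
  unfold g
  simp only [intervalIntegral.integral_of_le Real.pi_pos.le]
  refine Measurable.mul (by fun_prop) (StronglyMeasurable.measurable ?_)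
  refine StronglyMeasurable.integral_prod_right (f := fun (q : ℝ × ℝ) (φ : ℝ) =>
    f (√(q.1 ^ 2 + q.2 ^ 2 - 2 * q.1 * q.2 * Real.cos φ))) ?_
  exact Measurable.stronglyMeasurable (by unfold Function.uncurry; fun_prop)

/-- A weighted average against `g` is integrable over the plane if the weight is. -/
lemma integrableOn_integral_mul_g {f : ℝ → ℝ} (hf : Measurable f) (hf0 : ∀ t, 0 ≤ f t)
    (hf1 : (∫ y : EuclideanSpace ℝ (Fin 2), f ‖y‖) = 1)
    {h : ℝ → ℝ} (hm : Measurable h) (h0 : ∀ u, 0 < u → 0 ≤ h u)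
    (hi : IntegrableOn (fun u => u * h u) (Ioi 0)) :
    IntegrableOn (fun s => (∫ u in Ioi 0, h u * g f u s) * s) (Ioi 0) := by
  have hA0 : ∀ s, 0 ≤ ∫ u in Ioi 0, h u * g f u s := fun s =>
    setIntegral_nonneg measurableSet_Ioi fun u hu =>
      mul_nonneg (h0 u hu) (g_nonneg hf0 (le_of_lt hu) s)
  have hmeas : Measurable fun s => ∫ u in Ioi 0, h u * g f u s := by
    refine StronglyMeasurable.measurable (StronglyMeasurable.integral_prod_right
      (f := fun s u => h u * g f u s) (Measurable.stronglyMeasurable ?_))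
    exact (hm.comp measurable_snd).mul ((measurable_g hf).comp measurable_swap)
  refine ⟨(hmeas.mul measurable_id).aestronglyMeasurable, ?_⟩
  rw [hasFiniteIntegral_iff_ofReal ((ae_restrict_mem measurableSet_Ioi).mono fun s hs =>
    mul_nonneg (hA0 s) (le_of_lt hs))]
  have hle : ∀ s, ENNReal.ofReal (∫ u in Ioi 0, h u * g f u s) ≤
      ∫⁻ u in Ioi 0, ENNReal.ofReal (h u) * lg f u s := by
    intro s
    rw [integral_eq_lintegral_of_nonneg_ae]
    · refine ENNReal.ofReal_toReal_le.trans
        (setLIntegral_mono' measurableSet_Ioi fun u hu => ?_)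
      rw [ENNReal.ofReal_mul (h0 u hu), g_eq_toReal_lg hf hf0 (le_of_lt hu)]
      gcongr
      exact ENNReal.ofReal_toReal_le
    · exact (ae_restrict_mem measurableSet_Ioi).mono fun u hu =>
        mul_nonneg (h0 u hu) (g_nonneg hf0 (le_of_lt hu) s)
    · exact (hm.mul ((measurable_g hf).comp measurable_prodMk_right)).aestronglyMeasurable
  have hlm : Measurable fun p : ℝ × ℝ => lg f p.1 p.2 := measurable_lg hf
  have hls : ∀ s, Measurable fun u => lg f u s := fun s => hlm.comp measurable_prodMk_right
  calc ∫⁻ s in Ioi 0, ENNReal.ofReal ((∫ u in Ioi 0, h u * g f u s) * s)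
      ≤ ∫⁻ s in Ioi 0, ∫⁻ u in Ioi 0, ENNReal.ofReal (h u) * lg f u s * ENNReal.ofReal s := by
        refine lintegral_mono fun s => ?_
        rw [ENNReal.ofReal_mul (hA0 s)]
        refine le_of_le_of_eq ?_
          (lintegral_mul_const _ (hm.ennreal_ofReal.mul (hls s))).symm
        gcongr
        exact hle s
    _ = ∫⁻ u in Ioi 0, ∫⁻ s in Ioi 0, ENNReal.ofReal (h u) * lg f u s * ENNReal.ofReal s := by
        refine lintegral_lintegral_swap (Measurable.aemeasurable ?_)
        exact ((hm.comp measurable_snd).ennreal_ofReal.mul (hlm.comp measurable_swap)).mul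
          measurable_fst.ennreal_ofReal
    _ = ∫⁻ u in Ioi 0, ENNReal.ofReal (u * h u) := by
        refine setLIntegral_congr_fun measurableSet_Ioi fun u hu => ?_
        have hu' : 0 ≤ u := le_of_lt hu
        calc ∫⁻ s in Ioi 0, ENNReal.ofReal (h u) * lg f u s * ENNReal.ofReal s
            = ∫⁻ s in Ioi 0, ENNReal.ofReal (u * h u) * lg f s u := by
              refine setLIntegral_congr_fun measurableSet_Ioi fun s hs => ?_
              rw [mul_assoc, mul_comm (lg f u s), ofReal_mul_lg_comm f hu' (le_of_lt hs),
                ENNReal.ofReal_mul hu', ← mul_assoc, mul_comm (ENNReal.ofReal (h u))]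
          _ = ENNReal.ofReal (u * h u) := by
              rw [lintegral_const_mul _ (hls u),
                lintegral_lg hf hf0 hf1, mul_one]
    _ < ∞ := (hasFiniteIntegral_iff_ofReal ((ae_restrict_mem measurableSet_Ioi).mono
        fun u hu => mul_nonneg (le_of_lt hu) (h0 u hu))).1 hi.2

lemma one_sub_setIntegral_eq {f : ℝ → ℝ} (hf : Measurable f) (hf0 : ∀ t, 0 ≤ f t)
    (hf1 : (∫ y : EuclideanSpace ℝ (Fin 2), f ‖y‖) = 1) {r : ℝ} (hr : 0 < r)
    {w : ℝ → ℝ} (hw : Measurable w) (hw01 : ∀ u, 0 < u → w u ∈ Icc (0 : ℝ) 1) (s : ℝ) :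
    1 - ∫ u in Ioi r, w u * g f u s =
      ∫ u in Ioi 0, (1 - (Ioi r).indicator w u) * g f u s := by
  have hg := integrableOn_g hf hf0 hf1 s
  have hwg : IntegrableOn (fun u => w u * g f u s) (Ioi 0) := by
    refine Integrable.bdd_mul (c := 1) hg hw.aestronglyMeasurable ?_
    filter_upwards [ae_restrict_mem measurableSet_Ioi] with u hu
    rw [Real.norm_of_nonneg (hw01 u hu).1]
    exact (hw01 u hu).2
  have hind : ∀ u, (1 - (Ioi r).indicator w u) * g f u s =
      g f u s - (Ioi r).indicator (fun u => w u * g f u s) u := by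
    intro u
    by_cases hu : u ∈ Ioi r <;> simp [hu, sub_mul]
  simp only [hind]
  rw [integral_sub hg (hwg.indicator measurableSet_Ioi), integral_g hf hf0 hf1,
    setIntegral_indicator measurableSet_Ioi, inter_eq_right.2 (Ioi_subset_Ioi hr.le)]

theorem M_exponent_finite
    (f : ℝ → ℝ) (hf : Measurable f) (hf0 : ∀ t, 0 ≤ f t)
    (hf1 : (∫ y : EuclideanSpace ℝ (Fin 2), f ‖y‖) = 1)
    (ℓ : ℝ → ℝ) (hℓm : Measurable ℓ) (hℓpos : ∀ u, 0 < u → 0 < ℓ u)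
    (hℓint : ∀ ε, 0 < ε → IntegrableOn (fun u => u * ℓ u) (Set.Ioi ε))
    (α : ℝ) (hα : 0 < α) (r θ : ℝ) (hr : 0 < r) (hθ : 0 < θ) :
    (∫ s in Set.Ioi (0:ℝ), (1 - Cfun f ℓ α r s θ) * s)
        ≤ α * ∫ s in Set.Ioi (0:ℝ),
            (1 - ∫ u in Set.Ioi r, (1 + θ * ℓ u / ℓ r)⁻¹ * g f u s) * s ∧
      IntegrableOn
        (fun s => (1 - ∫ u in Set.Ioi r, (1 + θ * ℓ u / ℓ r)⁻¹ * g f u s) * s)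
        (Set.Ioi (0:ℝ)) ∧
      IntegrableOn (fun s => (1 - Cfun f ℓ α r s θ) * s) (Set.Ioi (0:ℝ)) := by
  set w : ℝ → ℝ := fun u => (1 + θ * ℓ u / ℓ r)⁻¹ with hw
  have hx : ∀ u, 0 < u → 0 ≤ θ * ℓ u / ℓ r := fun u hu =>
    div_nonneg (mul_nonneg hθ.le (hℓpos u hu).le) (hℓpos r hr).le
  have hw01 : ∀ u, 0 < u → w u ∈ Icc (0 : ℝ) 1 := fun u hu =>
    ⟨inv_nonneg.2 (by linarith [hx u hu]), inv_le_one_of_one_le₀ (by linarith [hx u hu])⟩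
  have hwm : Measurable w := by fun_prop
  set h : ℝ → ℝ := fun u => 1 - (Ioi r).indicator w u with hh
  have hhm : Measurable h := measurable_const.sub (hwm.indicator measurableSet_Ioi)
  have hh0 : ∀ u, 0 < u → 0 ≤ h u := by
    intro u hu
    by_cases hur : u ∈ Ioi r <;> simp [hh, hur, (hw01 u hu).2]
  have hhi : IntegrableOn (fun u => u * h u) (Ioi 0) := by
    rw [← Ioc_union_Ioi_eq_Ioi hr.le]
    refine IntegrableOn.union ?_ ?_
    · refine IntegrableOn.congr_fun (f := fun u => u) ?_ (fun u hu => ?_) measurableSet_Ioc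
      · exact continuous_id.integrableOn_Ioc
      · simp [hh, hu.2]
    · refine Integrable.mono' ((hℓint r hr).const_mul (θ / ℓ r))
        (measurable_id.mul hhm).aestronglyMeasurable ?_
      filter_upwards [ae_restrict_mem measurableSet_Ioi] with u hu
      have hu0 : 0 < u := hr.trans hu
      rw [Real.norm_of_nonneg (mul_nonneg hu0.le (hh0 u hu0))]
      have hle : h u ≤ θ * ℓ u / ℓ r := by
        simp only [hh, hw, indicator_of_mem hu]
        have h1 : 0 < 1 + θ * ℓ u / ℓ r := by linarith [hx u hu0]
        linarith [Real.one_sub_inv_le_log_of_pos h1, Real.log_le_sub_one_of_pos h1]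
      calc u * h u ≤ u * (θ * ℓ u / ℓ r) := by gcongr
        _ = θ / ℓ r * (u * ℓ u) := by ring
  set A : ℝ → ℝ := fun s => 1 - ∫ u in Ioi r, w u * g f u s with hA
  have hAeq : ∀ s, A s = ∫ u in Ioi 0, h u * g f u s := fun s =>
    one_sub_setIntegral_eq hf hf0 hf1 hr hwm hw01 s
  have hA0 : ∀ s, 0 ≤ A s := fun s => by
    rw [hAeq]
    exact setIntegral_nonneg measurableSet_Ioi fun u hu =>
      mul_nonneg (hh0 u hu) (g_nonneg hf0 (le_of_lt hu) s)
  have hAi : IntegrableOn (fun s => A s * s) (Ioi 0) := by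
    simp only [hAeq]
    exact integrableOn_integral_mul_g hf hf0 hf1 hhm hh0 hhi
  have hAm : Measurable A := by
    refine measurable_const.sub (StronglyMeasurable.measurable
      (StronglyMeasurable.integral_prod_right
      (f := fun s u => w u * g f u s) (Measurable.stronglyMeasurable ?_)))
    exact (hwm.comp measurable_snd).mul ((measurable_g hf).comp measurable_swap)
  have hC : ∀ s, Cfun f ℓ α r s θ = Real.exp (-α * A s) := fun s => rfl
  have hC0 : ∀ s, 0 ≤ 1 - Cfun f ℓ α r s θ := fun s => by
    rw [hC, sub_nonneg, Real.exp_le_one_iff]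
    nlinarith [hA0 s]
  have hCle : ∀ s ∈ Ioi (0 : ℝ), (1 - Cfun f ℓ α r s θ) * s ≤ α * (A s * s) := by
    intro s hs
    rw [← mul_assoc]
    refine mul_le_mul_of_nonneg_right ?_ (le_of_lt hs)
    rw [hC]
    linarith [Real.add_one_le_exp (-α * A s)]
  have hCi : IntegrableOn (fun s => (1 - Cfun f ℓ α r s θ) * s) (Ioi 0) := by
    refine Integrable.mono' (hAi.const_mul α) ?_ ?_
    · simp only [hC]
      exact Measurable.aestronglyMeasurable (by fun_prop)
    · filter_upwards [ae_restrict_mem measurableSet_Ioi] with s hs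
      rw [Real.norm_of_nonneg (mul_nonneg (hC0 s) (le_of_lt hs))]
      exact hCle s hs
  refine ⟨?_, hAi, hCi⟩
  rw [← integral_const_mul]
  exact setIntegral_mono_on hCi (hAi.const_mul α) measurableSet_Ioi hCle
end
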